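/- (Front-door adjustment, Step 1: P(z|do(x)) = P(z|x).) For every x : 𝒳 with P(x) > 0 and every z : 𝒵, the interventional probability of Z = z under do(X = x) equals the observational conditional probability: Σ_y P(z, y | do(x)) = P(x, z) / P(x), where P(x, z) = Σ_{u, y} P(u, x, z, y) and P(x) = Σ_{u, z, y} P(u, x, z, y). -/

import Mathlib

/- Causal Bayesian network of Figure 1: latent `U`, structure `X ← U → Y`, `X → Z → Y`.
The observational joint is `P(u,x,z,y) = pU u * pX u x * pZ x z * pY u z y`. -/

/-- Step 1 of the front-door adjustment: `P(z | do(x)) = P(z | x)`. -/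
theorem frontdoor_step1 {𝒰 𝒳 𝒵 𝒴 : Type*} [Fintype 𝒰] [Fintype 𝒳] [Fintype 𝒵] [Fintype 𝒴]
    [Nonempty 𝒰] [Nonempty 𝒳] [Nonempty 𝒵] [Nonempty 𝒴]
    (pU : 𝒰 → ℝ) (pX : 𝒰 → 𝒳 → ℝ) (pZ : 𝒳 → 𝒵 → ℝ) (pY : 𝒰 → 𝒵 → 𝒴 → ℝ)
    (hU0 : ∀ u, 0 ≤ pU u) (hX0 : ∀ u x, 0 ≤ pX u x)
    (hZ0 : ∀ x z, 0 ≤ pZ x z) (hY0 : ∀ u z y, 0 ≤ pY u z y)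
    (hU1 : ∑ u, pU u = 1) (hX1 : ∀ u, ∑ x, pX u x = 1)
    (hZ1 : ∀ x, ∑ z, pZ x z = 1) (hY1 : ∀ u z, ∑ y, pY u z y = 1)
    (x : 𝒳) (hx : 0 < ∑ u, ∑ z, ∑ y, pU u * pX u x * pZ x z * pY u z y) (z : 𝒵) :
    ∑ y, (∑ u, pU u * pZ x z * pY u z y) =
      (∑ u, ∑ y, pU u * pX u x * pZ x z * pY u z y) /
        (∑ u, ∑ z', ∑ y, pU u * pX u x * pZ x z' * pY u z' y) := by
  rw [eq_div_iff hx.ne', Finset.sum_comm]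
  simp only [← Finset.mul_sum, ← Finset.sum_mul, hY1, hZ1, hU1, mul_one, one_mul]
  exact mul_comm _ _
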